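/- Property (partial sort of set B suffices): let n ≥ 1 and p1, p2 : Fin n → ℕ with p1(j) > p2(j) for every job j (all jobs belong to Johnson's set B), with the jobs indexed so that p2 is nonincreasing (Johnson order), and let pmax2 = max_j p2(j). Suppose k ≥ 1 satisfies ∑_{i ≥ k} p2(i) ≤ ∑_{i ≥ k} p1(i) − pmax2. Then for every permutation σ of Fin n with σ(i) = i for all i ≥ k (jobs 0, …, k−1 in an arbitrary order, followed by jobs k, …, n−1 in sorted order), Cmax(σ) = Cmax(identity); in particular every such σ is an optimal schedule. -/

import Mathlib

/-- Makespan of a permutation schedule in the two-machine flow shop. -/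
def Cmax (n : ℕ) (p1 p2 : Fin n → ℕ) (σ : Equiv.Perm (Fin n)) : ℕ :=
  Finset.univ.sup
    (fun k : Fin n => (∑ i ∈ Finset.Iic k, p1 (σ i)) + ∑ i ∈ Finset.Ici k, p2 (σ i))

/-- Enlarging the index set increases the sum of the larger function at least as much. -/
lemma Finset.sum_add_sum_le_of_subset {ι : Type*} [DecidableEq ι] {s t : Finset ι}
    {f g : ι → ℕ} (hst : s ⊆ t) (hfg : ∀ i, f i ≤ g i) :
    ∑ i ∈ t, f i + ∑ i ∈ s, g i ≤ ∑ i ∈ t, g i + ∑ i ∈ s, f i := by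
  rw [← Finset.sum_sdiff hst, ← Finset.sum_sdiff (f := g) hst]
  have := Finset.sum_le_sum fun i (_ : i ∈ t \ s) => hfg i
  omega

/-- The length of the critical path through position `t`, expressed by the jobs after `t`. -/
lemma path_add_sum_Ioi {n : ℕ} (p1 p2 : Fin n → ℕ) (π : Equiv.Perm (Fin n)) (t : Fin n) :
    ∑ i ∈ Finset.Iic t, p1 (π i) + ∑ i ∈ Finset.Ici t, p2 (π i) + ∑ i ∈ Finset.Ioi t, p1 (π i) =
      ∑ i, p1 i + p2 (π t) + ∑ i ∈ Finset.Ioi t, p2 (π i) := by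
  have hcompl : (Finset.Iic t)ᶜ = Finset.Ioi t := by ext; simp
  have htotal := Finset.sum_add_sum_compl (Finset.Iic t) fun i => p1 (π i)
  rw [hcompl, Equiv.sum_comp π p1] at htotal
  have hhead : ∑ i ∈ Finset.Ici t, p2 (π i) = p2 (π t) + ∑ i ∈ Finset.Ioi t, p2 (π i) := by
    rw [← Finset.Ioi_insert, Finset.sum_insert (by simp)]
  omega

lemma path_le_Cmax {n : ℕ} (p1 p2 : Fin n → ℕ) (π : Equiv.Perm (Fin n)) (t : Fin n) :
    ∑ i ∈ Finset.Iic t, p1 (π i) + ∑ i ∈ Finset.Ici t, p2 (π i) ≤ Cmax n p1 p2 π :=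
  Finset.le_sup (f := fun k : Fin n =>
    ∑ i ∈ Finset.Iic k, p1 (π i) + ∑ i ∈ Finset.Ici k, p2 (π i)) (Finset.mem_univ t)

lemma sum_le_Cmax {n : ℕ} (p1 p2 : Fin n → ℕ) (π : Equiv.Perm (Fin n)) :
    ∑ i, p1 i ≤ Cmax n p1 p2 π := by
  rcases n with _ | n
  · simp
  · have hpath := path_add_sum_Ioi p1 p2 π (Fin.last n)
    have hle := path_le_Cmax p1 p2 π (Fin.last n)
    have hlast : Finset.Ioi (Fin.last n) = ∅ := by ext i; simp [Fin.le_last]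
    simp only [hlast, Finset.sum_empty] at hpath
    omega

/-- In Johnson order, the critical path through `m` bounds every makespan from below. -/
lemma sum_add_sum_Ioi_le_Cmax_add {n : ℕ} {p1 p2 : Fin n → ℕ} (hB : ∀ j, p2 j ≤ p1 j)
    (hanti : Antitone p2) (π : Equiv.Perm (Fin n)) (m : Fin n) :
    ∑ i, p1 i + p2 m + ∑ i ∈ Finset.Ioi m, p2 i ≤
      Cmax n p1 p2 π + ∑ i ∈ Finset.Ioi m, p1 i := by
  -- the last position holding a job of index at most `m`
  obtain ⟨t, ht, hmax⟩ := Finset.exists_max_image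
    (Finset.univ.filter fun i => π i ≤ m) id ⟨π.symm m, by simp⟩
  have htm : π t ≤ m := by simpa using ht
  have hsub : (Finset.Ioi t).map π.toEmbedding ⊆ Finset.Ioi m := by
    intro j hj
    obtain ⟨i, hi, rfl⟩ := Finset.mem_map.mp hj
    rw [Finset.mem_Ioi] at hi ⊢
    by_contra hle
    exact absurd (hmax i (by simpa using hle)) (not_le.mpr hi)
  have hswap := Finset.sum_add_sum_le_of_subset hsub hB
  simp only [Finset.sum_map, Equiv.coe_toEmbedding] at hswap
  have hpath := path_add_sum_Ioi p1 p2 π t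
  have hle := path_le_Cmax p1 p2 π t
  have hp2 := hanti htm
  omega

/-- A schedule that is sorted from position `k` on is optimal, provided the sorted tail is
long enough on the first machine. -/
lemma Cmax_le_of_sorted_tail {n : ℕ} {p1 p2 : Fin n → ℕ} (hB : ∀ j, p2 j ≤ p1 j)
    (hanti : Antitone p2) {k : Fin n}
    (hsum : ∑ i ∈ Finset.Ici k, p2 i + Finset.univ.sup p2 ≤ ∑ i ∈ Finset.Ici k, p1 i)
    {σ : Equiv.Perm (Fin n)} (hσ : ∀ i, k ≤ i → σ i = i) (π : Equiv.Perm (Fin n)) :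
    Cmax n p1 p2 σ ≤ Cmax n p1 p2 π := by
  refine Finset.sup_le fun m _ => ?_
  have hpath := path_add_sum_Ioi p1 p2 σ m
  have htail {s : Finset (Fin n)} (hs : ∀ i ∈ s, k ≤ i) (f : Fin n → ℕ) :
      ∑ i ∈ s, f (σ i) = ∑ i ∈ s, f i :=
    Finset.sum_congr rfl fun i hi => by rw [hσ i (hs i hi)]
  rcases lt_or_ge m k with hm | hm
  · have hsub : Finset.Ici k ⊆ Finset.Ioi m := fun i hi =>
      Finset.mem_Ioi.mpr (hm.trans_le (Finset.mem_Ici.mp hi))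
    have hswap := Finset.sum_add_sum_le_of_subset hsub fun i => hB (σ i)
    have hIci : ∀ i ∈ Finset.Ici k, k ≤ i := fun i => Finset.mem_Ici.mp
    rw [htail hIci p1, htail hIci p2] at hswap
    have hsup : p2 (σ m) ≤ Finset.univ.sup p2 := Finset.le_sup (Finset.mem_univ _)
    have htotal := sum_le_Cmax p1 p2 π
    omega
  · have hIoi : ∀ i ∈ Finset.Ioi m, k ≤ i := fun i hi => hm.trans (Finset.mem_Ioi.mp hi).le
    rw [htail hIoi p1, htail hIoi p2, hσ m hm] at hpath
    have hlower := sum_add_sum_Ioi_le_Cmax_add hB hanti π m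
    omega

/-- Partial sort of set B suffices: if all jobs belong to Johnson's set B
(`p1 j > p2 j`), are indexed in nonincreasing order of `p2` (Johnson order),
and `∑_{i ≥ k} p2 i + pmax2 ≤ ∑_{i ≥ k} p1 i` where `pmax2 = max_j p2 j`, then
every permutation fixing positions `k, …, n−1` (first jobs in arbitrary order)
has the same makespan as the identity (Johnson) sequence, and is optimal. -/
theorem flowshop_partial_sort_B
    (n : ℕ) (hn : 0 < n) (p1 p2 : Fin n → ℕ)
    (hB : ∀ j, p2 j < p1 j)
    (hanti : Antitone p2)
    (k : Fin n) (hk : 1 ≤ k.val)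
    (hsum : (∑ i ∈ Finset.Ici k, p2 i) + Finset.univ.sup p2 ≤ ∑ i ∈ Finset.Ici k, p1 i)
    (σ : Equiv.Perm (Fin n)) (hσ : ∀ i : Fin n, k ≤ i → σ i = i) :
    Cmax n p1 p2 σ = Cmax n p1 p2 1 ∧
      ∀ π : Equiv.Perm (Fin n), Cmax n p1 p2 σ ≤ Cmax n p1 p2 π := by
  have hB' : ∀ j, p2 j ≤ p1 j := fun j => (hB j).le
  have hopt := Cmax_le_of_sorted_tail hB' hanti hsum hσ
  exact ⟨(hopt 1).antisymm (Cmax_le_of_sorted_tail hB' hanti hsum (fun _ _ => rfl) σ), hopt⟩
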